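/- Let n ≥ 0 and 0 ≤ k ≤ n be integers, and let P : End(V_n) → V_{2k} be a ℂ-linear map which is sl(2)-equivariant, i.e. P(L_n T − T L_n) = L_{2k} P(T) and P(R_n T − T R_n) = R_{2k} P(T) for all T ∈ End(V_n). Then there exists a constant c ∈ ℂ, independent of T, with the following property: for every T ∈ End(V_n) whose matrix in the basis (g_{n,0}, …, g_{n,n}) is upper triangular with diagonal entries a_0, …, a_n, writing P(T) = Σ_{u=0}^{2k} b_u g_{2k,u}, one has b_u = 0 for every u > k, and b_k = c · Σ_{i=0}^{n} B_{n,k,i} a_i. -/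

import Mathlib

noncomputable section

/-- The lowering operator `L_n` on `V_n = ℂ^{n+1}`, determined by
`L_n g_{n,i} = (n - i) g_{n,i+1}`. -/
def Lop (n : ℕ) : (Fin (n + 1) → ℂ) →ₗ[ℂ] (Fin (n + 1) → ℂ) :=
  Matrix.toLin' (fun j i => if (j : ℕ) = (i : ℕ) + 1 then ((n : ℂ) - (i : ℕ)) else 0)

/-- The raising operator `R_n` on `V_n = ℂ^{n+1}`, determined by
`R_n g_{n,i} = i g_{n,i-1}`. -/
def Rop (n : ℕ) : (Fin (n + 1) → ℂ) →ₗ[ℂ] (Fin (n + 1) → ℂ) :=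
  Matrix.toLin' (fun j i => if (i : ℕ) = (j : ℕ) + 1 then ((i : ℕ) : ℂ) else 0)

/-- `B_{n,k,i} = Σ_{a+b=k} (−1)^a binom(n,i) binom(i,a) binom(n−i,b) (n−i+a)! (i+b)!`. -/
def B (n k i : ℕ) : ℤ :=
  ∑ a ∈ Finset.range (k + 1),
    (-1 : ℤ) ^ a * (Nat.choose n i : ℤ) * (Nat.choose i a : ℤ)
      * (Nat.choose (n - i) (k - a) : ℤ)
      * (Nat.factorial (n - i + a) : ℤ) * (Nat.factorial (i + (k - a)) : ℤ)

/-- The `m`-th coordinate of `v`, extended by zero to all natural numbers `m`. -/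
def coord (n m : ℕ) : (Fin (n + 1) → ℂ) →ₗ[ℂ] ℂ :=
  if h : m < n + 1 then LinearMap.proj ⟨m, h⟩ else 0

lemma coord_val {n : ℕ} (v : Fin (n + 1) → ℂ) (i : Fin (n + 1)) : coord n i v = v i := by
  rw [coord, dif_pos i.isLt]; rfl

lemma coord_of_lt {n m : ℕ} (h : n < m) : coord n m = 0 := by
  simp [coord, show ¬ m < n + 1 by omega]

lemma ext_coord {n : ℕ} {v w : Fin (n + 1) → ℂ} (h : ∀ m ≤ n, coord n m v = coord n m w) :
    v = w := by
  funext i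
  simpa only [coord_val] using h i (by omega)

lemma Rop_apply (n : ℕ) (v : Fin (n + 1) → ℂ) (j : Fin (n + 1)) :
    Rop n v j = ∑ i : Fin (n + 1), (if (i : ℕ) = (j : ℕ) + 1 then ((i : ℕ) : ℂ) else 0) * v i :=
  congrFun (Matrix.toLin'_apply _ v) j

lemma Lop_apply (n : ℕ) (v : Fin (n + 1) → ℂ) (j : Fin (n + 1)) :
    Lop n v j =
      ∑ i : Fin (n + 1), (if (j : ℕ) = (i : ℕ) + 1 then ((n : ℂ) - (i : ℕ)) else 0) * v i :=
  congrFun (Matrix.toLin'_apply _ v) j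

lemma coord_Rop (n m : ℕ) (v : Fin (n + 1) → ℂ) :
    coord n m (Rop n v) = (m + 1) * coord n (m + 1) v := by
  rcases lt_or_ge m n with h | h
  · have key : Rop n v ⟨m, by omega⟩ = (m + 1) * v ⟨m + 1, by omega⟩ := by
      rw [Rop_apply, Finset.sum_eq_single ⟨m + 1, by omega⟩]
      · simp
      · intro b _ hb
        simp [show (b : ℕ) ≠ m + 1 from fun e => hb (Fin.ext e)]
      · simp
    simpa [← coord_val] using key
  · rw [coord_of_lt (show n < m + 1 by omega)]
    rcases h.eq_or_lt with rfl | h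
    · have key : Rop n v ⟨n, by omega⟩ = 0 := by
        rw [Rop_apply]
        refine Finset.sum_eq_zero fun b _ => ?_
        simp [show (b : ℕ) ≠ n + 1 by omega]
      simpa [← coord_val] using key
    · simp [coord_of_lt h]

lemma coord_zero_Lop (n : ℕ) (v : Fin (n + 1) → ℂ) : coord n 0 (Lop n v) = 0 := by
  have key : Lop n v ⟨0, by omega⟩ = 0 := by
    rw [Lop_apply]
    exact Finset.sum_eq_zero fun b _ => by simp
  simpa [← coord_val] using key

lemma coord_succ_Lop (n m : ℕ) (v : Fin (n + 1) → ℂ) :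
    coord n (m + 1) (Lop n v) = (n - m) * coord n m v := by
  rcases lt_or_ge m n with h | h
  · have key : Lop n v ⟨m + 1, by omega⟩ = (n - m) * v ⟨m, by omega⟩ := by
      rw [Lop_apply, Finset.sum_eq_single ⟨m, by omega⟩]
      · simp
      · intro b _ hb
        simp [show m ≠ (b : ℕ) from fun e => hb (Fin.ext e.symm)]
      · simp
    simpa [← coord_val] using key
  · rw [coord_of_lt (show n < m + 1 by omega)]
    rcases h.eq_or_lt with rfl | h
    · simp
    · simp [coord_of_lt h]

/-- The operator `[R_n, L_n]` acts on `g_{n,m}` by the weight `n - 2m`. -/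
lemma coord_weight (n m : ℕ) (v : Fin (n + 1) → ℂ) :
    coord n m (Rop n (Lop n v)) - coord n m (Lop n (Rop n v)) = (n - 2 * m) * coord n m v := by
  cases m with
  | zero => simp [coord_Rop, coord_succ_Lop, coord_zero_Lop]
  | succ m => simp only [coord_Rop, coord_succ_Lop]; push_cast; ring

/-- The matrix unit sending `g_{n,j}` to `g_{n,i}`, which is zero if `i` or `j` exceeds `n`. -/
def matUnit (n i j : ℕ) : (Fin (n + 1) → ℂ) →ₗ[ℂ] (Fin (n + 1) → ℂ) :=
  LinearMap.pi fun r => if (r : ℕ) = i then coord n j else 0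

lemma coord_matUnit {n i : ℕ} (hi : i ≤ n) (j r : ℕ) (v : Fin (n + 1) → ℂ) :
    coord n r (matUnit n i j v) = if r = i then coord n j v else 0 := by
  by_cases h : r < n + 1
  · have := coord_val (matUnit n i j v) ⟨r, h⟩
    simp only at this
    rw [this, matUnit, LinearMap.pi_apply]
    split_ifs <;> rfl
  · rw [coord_of_lt (by omega), if_neg (by omega), LinearMap.zero_apply]

lemma matUnit_of_lt_right {n j : ℕ} (h : n < j) (i : ℕ) : matUnit n i j = 0 := by
  ext
  simp [matUnit, coord_of_lt h]

lemma Rop_comm_matUnit {n i : ℕ} (hi : i ≤ n) (j : ℕ) :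
    (Rop n).comp (matUnit n i j) - (matUnit n i j).comp (Rop n) =
      (i : ℂ) • matUnit n (i - 1) j - ((j : ℂ) + 1) • matUnit n i (j + 1) := by
  refine LinearMap.ext fun v => ext_coord fun r _ => ?_
  simp only [LinearMap.sub_apply, LinearMap.comp_apply, LinearMap.smul_apply, map_sub, map_smul,
    coord_Rop, coord_matUnit hi, coord_matUnit (show i - 1 ≤ n by omega), smul_eq_mul]
  cases i with
  | zero => simp
  | succ i =>
    simp only [Nat.add_right_cancel_iff, Nat.add_sub_cancel]
    by_cases h : r = i
    · subst h; simp
    · simp [h]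

lemma Lop_comm_matUnit {n i : ℕ} (hi : i < n) (j : ℕ) :
    (Lop n).comp (matUnit n i (j + 1)) - (matUnit n i (j + 1)).comp (Lop n) =
      ((n : ℂ) - i) • matUnit n (i + 1) (j + 1) - ((n : ℂ) - j) • matUnit n i j := by
  refine LinearMap.ext fun v => ext_coord fun r _ => ?_
  simp only [LinearMap.sub_apply, LinearMap.comp_apply, LinearMap.smul_apply, map_sub, map_smul,
    coord_succ_Lop, coord_matUnit hi.le, coord_matUnit (show i + 1 ≤ n by omega), smul_eq_mul]
  cases r with
  | zero => simp [coord_zero_Lop]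
  | succ r =>
    rw [coord_succ_Lop, coord_matUnit hi.le]
    by_cases h : r = i
    · subst h; simp
    · simp [h]

lemma weight_comm_matUnit {n i : ℕ} (hi : i ≤ n) (j : ℕ) :
    ((Rop n).comp ((Lop n).comp (matUnit n i j) - (matUnit n i j).comp (Lop n)) -
        ((Lop n).comp (matUnit n i j) - (matUnit n i j).comp (Lop n)).comp (Rop n)) -
      ((Lop n).comp ((Rop n).comp (matUnit n i j) - (matUnit n i j).comp (Rop n)) -
        ((Rop n).comp (matUnit n i j) - (matUnit n i j).comp (Rop n)).comp (Lop n)) =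
      (2 * ((j : ℂ) - i)) • matUnit n i j := by
  refine LinearMap.ext fun v => ext_coord fun r _ => ?_
  have h₁ := coord_weight n r (matUnit n i j v)
  have h₂ := coord_weight n j v
  simp only [coord_matUnit hi] at h₁
  simp only [LinearMap.sub_apply, LinearMap.comp_apply, LinearMap.smul_apply, map_sub, map_smul,
    coord_matUnit hi, smul_eq_mul]
  by_cases h : r = i
  · subst h
    simp only [if_true] at h₁ ⊢
    linear_combination h₁ - h₂
  · simp only [h, if_false] at h₁ ⊢
    linear_combination h₁

lemma eq_sum_matUnit {n : ℕ} (T : (Fin (n + 1) → ℂ) →ₗ[ℂ] (Fin (n + 1) → ℂ)) :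
    T = ∑ i : Fin (n + 1), ∑ j : Fin (n + 1), LinearMap.toMatrix' T i j • matUnit n i j := by
  refine LinearMap.ext fun v => funext fun r => ?_
  conv_lhs => rw [← LinearMap.toMatrix'_mulVec T v]
  simp only [Matrix.mulVec, dotProduct, LinearMap.sum_apply, LinearMap.smul_apply, Finset.sum_apply,
    Pi.smul_apply, smul_eq_mul]
  refine Eq.symm ?_
  rw [Finset.sum_eq_single r]
  · simp only [matUnit, LinearMap.pi_apply, if_true, coord_val]
  · intro b _ hb
    refine Finset.sum_eq_zero fun j _ => ?_
    simp [matUnit, show (r : ℕ) ≠ b from fun e => hb (Fin.ext e.symm)]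
  · simp

lemma factorial_mul_choose_mul_factorials {n i : ℕ} (hi : i ≤ n) (a b : ℕ) :
    n.factorial * ((a + b).choose a * (i.descFactorial a * (i + 1).ascFactorial b) *
        (n - i + a).choose (a + b)) =
      n.choose i * i.choose a * (n - i).choose b * (n - i + a).factorial * (i + b).factorial := by
  rcases lt_or_ge i a with ha | ha
  · simp [Nat.descFactorial_of_lt ha, Nat.choose_eq_zero_of_lt ha]
  rcases lt_or_ge (n - i) b with hb | hb
  · simp [Nat.choose_eq_zero_of_lt hb, Nat.choose_eq_zero_of_lt (show n - i + a < a + b by omega)]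
  obtain ⟨x, rfl⟩ := Nat.exists_eq_add_of_le ha
  obtain ⟨y, hy⟩ := Nat.exists_eq_add_of_le hb
  obtain rfl : n = a + x + (b + y) := by omega
  have e₁ := Nat.add_choose_mul_factorial_mul_factorial (a + x) (b + y)
  have e₂ := Nat.add_choose_mul_factorial_mul_factorial a x
  have e₃ := Nat.add_choose_mul_factorial_mul_factorial b y
  have e₄ := Nat.add_choose_mul_factorial_mul_factorial a b
  have e₅ := Nat.add_choose_mul_factorial_mul_factorial (a + b) y
  rw [← Nat.choose_symm_add] at e₁ e₂ e₃ e₄ e₅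
  have e₆ := Nat.factorial_mul_descFactorial (show a ≤ a + x by omega)
  have e₇ := Nat.factorial_mul_ascFactorial (a + x) b
  rw [show a + x - a = x by omega] at e₆
  have hpos : 0 < a.factorial * b.factorial * x.factorial * y.factorial * (a + x).factorial *
      (b + y).factorial * (a + b).factorial := by
    positivity
  rw [hy, show b + y + a = a + b + y by omega]
  apply Nat.eq_of_mul_eq_mul_left hpos
  trans (a + x + (b + y)).factorial * ((a + b).choose a * a.factorial * b.factorial) *
      (x.factorial * (a + x).descFactorial a) *
      ((a + x).factorial * (a + x + 1).ascFactorial b) *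
      ((a + b + y).choose (a + b) * (a + b).factorial * y.factorial) * (b + y).factorial
  · ring
  rw [e₄, e₅, e₆, e₇]
  trans ((a + x + (b + y)).choose (a + x) * (a + x).factorial * (b + y).factorial) *
      ((a + x).choose a * a.factorial * x.factorial) *
      ((b + y).choose b * b.factorial * y.factorial) * (a + b).factorial *
      (a + b + y).factorial * (a + x + b).factorial
  · rw [e₁, e₂, e₃]; ring
  · ring

section Equivariant

variable {n k : ℕ} {P : ((Fin (n + 1) → ℂ) →ₗ[ℂ] (Fin (n + 1) → ℂ)) →ₗ[ℂ] (Fin (2 * k + 1) → ℂ)}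

/-- An equivariant map preserves weights. -/
lemma coord_apply_matUnit_eq_zero
    (hPL : ∀ T : (Fin (n + 1) → ℂ) →ₗ[ℂ] (Fin (n + 1) → ℂ),
      P ((Lop n).comp T - T.comp (Lop n)) = (Lop (2 * k)) (P T))
    (hPR : ∀ T : (Fin (n + 1) → ℂ) →ₗ[ℂ] (Fin (n + 1) → ℂ),
      P ((Rop n).comp T - T.comp (Rop n)) = (Rop (2 * k)) (P T))
    {i j u : ℕ} (hi : i ≤ n) (h : j + u ≠ i + k) :
    coord (2 * k) u (P (matUnit n i j)) = 0 := by
  have key := congrArg (fun T => coord (2 * k) u (P T)) (weight_comm_matUnit hi j)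
  simp only [map_sub P (_ - _) (_ - _), hPR, hPL, map_smul, smul_eq_mul] at key
  rw [map_sub, coord_weight] at key
  have hne : (j : ℂ) + u - (i + k) ≠ 0 := sub_ne_zero.2 (by exact_mod_cast h)
  refine (mul_eq_zero.1 (?_ : ((j : ℂ) + u - (i + k)) * _ = 0)).resolve_left hne
  push_cast at key
  linear_combination (-1 / 2 : ℂ) * key

lemma factorial_mul_coord_apply_matUnit
    (hPR : ∀ T : (Fin (n + 1) → ℂ) →ₗ[ℂ] (Fin (n + 1) → ℂ),
      P ((Rop n).comp T - T.comp (Rop n)) = (Rop (2 * k)) (P T))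
    (m : ℕ) {i : ℕ} (hi : i ≤ n) (j : ℕ) :
    (m.factorial : ℂ) * coord (2 * k) m (P (matUnit n i j)) =
      ∑ p ∈ Finset.HasAntidiagonal.antidiagonal m, (m.choose p.1 : ℂ) *
        ((-1) ^ p.2 * (i.descFactorial p.1 : ℂ) * ((j + 1).ascFactorial p.2 : ℂ) *
          coord (2 * k) 0 (P (matUnit n (i - p.1) (j + p.2)))) := by
  induction m generalizing i j with
  | zero => simp
  | succ m ih =>
    have hrec : ((m : ℂ) + 1) * coord (2 * k) (m + 1) (P (matUnit n i j)) =
        i * coord (2 * k) m (P (matUnit n (i - 1) j)) -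
          (j + 1) * coord (2 * k) m (P (matUnit n i (j + 1))) := by
      rw [← coord_Rop, ← hPR, Rop_comm_matUnit hi]
      simp only [map_sub, map_smul, smul_eq_mul]
    rw [Finset.sum_antidiagonal_choose_succ_mul (fun a b => (-1) ^ b * (i.descFactorial a : ℂ) *
      ((j + 1).ascFactorial b : ℂ) * coord (2 * k) 0 (P (matUnit n (i - a) (j + b))))]
    have h₁ := ih (show i - 1 ≤ n by omega) j
    have h₂ := ih hi (j + 1)
    rw [Nat.factorial_succ]
    push_cast
    rw [mul_comm ((m : ℂ) + 1), mul_assoc, hrec, mul_sub, mul_left_comm, h₁, mul_left_comm, h₂,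
      sub_eq_add_neg, add_comm, Finset.mul_sum, Finset.mul_sum, ← Finset.sum_neg_distrib]
    congr 1
    · refine Finset.sum_congr rfl fun p _ => ?_
      have e : (j + 1).ascFactorial (p.2 + 1) = (j + 1) * (j + 1 + 1).ascFactorial p.2 := by
        rw [Nat.ascFactorial_succ]
        exact (Nat.succ_ascFactorial (j + 1) p.2).symm
      rw [e, show j + 1 + p.2 = j + (p.2 + 1) by omega]
      push_cast
      ring
    · refine Finset.sum_congr rfl fun p hp => ?_
      have e : i.descFactorial (p.1 + 1) = i * (i - 1).descFactorial p.1 := by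
        cases i with
        | zero => simp
        | succ i => exact Nat.succ_descFactorial_succ i p.1
      rw [e, show i - 1 - p.1 = i - (p.1 + 1) by omega,
        Nat.choose_symm_of_eq_add (Finset.HasAntidiagonal.mem_antidiagonal.1 hp).symm]
      push_cast
      ring

lemma choose_mul_coord_zero_apply_matUnit
    (hPL : ∀ T : (Fin (n + 1) → ℂ) →ₗ[ℂ] (Fin (n + 1) → ℂ),
      P ((Lop n).comp T - T.comp (Lop n)) = (Lop (2 * k)) (P T))
    {i : ℕ} (hi : i + k ≤ n) :
    (n.choose k : ℂ) * coord (2 * k) 0 (P (matUnit n i (i + k))) =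
      (n - i).choose k * coord (2 * k) 0 (P (matUnit n 0 k)) := by
  induction i with
  | zero => simp
  | succ i ih =>
    have hrec : ((n : ℂ) - i) * coord (2 * k) 0 (P (matUnit n (i + 1) (i + k + 1))) =
        (n - (i + k)) * coord (2 * k) 0 (P (matUnit n i (i + k))) := by
      have h := coord_zero_Lop (2 * k) (P (matUnit n i (i + k + 1)))
      rw [← hPL, Lop_comm_matUnit (by omega)] at h
      simp only [map_sub, map_smul, smul_eq_mul] at h
      push_cast at h
      linear_combination h
    have ih := ih (by omega)
    obtain ⟨d, hd⟩ := Nat.exists_eq_add_of_le hi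
    have hn : (n : ℂ) = i + 1 + k + d := by exact_mod_cast hd
    have hc : ((k + d).choose k : ℂ) * (k + d + 1) = (k + d + 1).choose k * (d + 1) := by
      have hc := Nat.choose_mul_succ_eq (k + d) k
      rw [show k + d + 1 - k = d + 1 by omega] at hc
      exact_mod_cast hc
    rw [show n - i = k + d + 1 by omega] at ih
    rw [show n - (i + 1) = k + d by omega, show i + 1 + k = i + k + 1 by omega]
    rw [hn] at hrec
    have hne : (k : ℂ) + d + 1 ≠ 0 := by exact_mod_cast (k + d).succ_ne_zero
    apply mul_left_cancel₀ hne
    linear_combination (n.choose k : ℂ) * hrec + (d + 1) * ih -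
      coord (2 * k) 0 (P (matUnit n 0 k)) * hc

lemma coord_apply_matUnit_diag (hk : k ≤ n)
    (hPL : ∀ T : (Fin (n + 1) → ℂ) →ₗ[ℂ] (Fin (n + 1) → ℂ),
      P ((Lop n).comp T - T.comp (Lop n)) = (Lop (2 * k)) (P T))
    (hPR : ∀ T : (Fin (n + 1) → ℂ) →ₗ[ℂ] (Fin (n + 1) → ℂ),
      P ((Rop n).comp T - T.comp (Rop n)) = (Rop (2 * k)) (P T))
    {i : ℕ} (hi : i ≤ n) :
    coord (2 * k) k (P (matUnit n i i)) =
      (-1) ^ k * coord (2 * k) 0 (P (matUnit n 0 k)) /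
        (k.factorial * n.factorial * n.choose k) * (B n k i : ℤ) := by
  have hk₀ : (k.factorial : ℂ) ≠ 0 := by exact_mod_cast k.factorial_ne_zero
  have hn₀ : (n.factorial : ℂ) ≠ 0 := by exact_mod_cast n.factorial_ne_zero
  have hc₀ : (n.choose k : ℂ) ≠ 0 := by exact_mod_cast (Nat.choose_pos hk).ne'
  rw [div_mul_eq_mul_div, eq_div_iff (by positivity)]
  have hsum := factorial_mul_coord_apply_matUnit hPR k hi i
  have hB : ((B n k i : ℤ) : ℂ) =
      ∑ p ∈ Finset.HasAntidiagonal.antidiagonal k, (-1) ^ p.1 * (n.choose i : ℂ) *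
        i.choose p.1 * (n - i).choose p.2 * (n - i + p.1).factorial * (i + p.2).factorial := by
    rw [Finset.Nat.sum_antidiagonal_eq_sum_range_succ_mk, B]
    push_cast
    rfl
  calc _ = (n.factorial * n.choose k : ℂ) *
        (k.factorial * coord (2 * k) k (P (matUnit n i i))) := by ring
    _ = _ := by
      rw [hsum, hB, Finset.mul_sum, Finset.mul_sum]
      refine Finset.sum_congr rfl fun p hp => ?_
      obtain ⟨a, b⟩ := p
      obtain rfl : a + b = k := Finset.HasAntidiagonal.mem_antidiagonal.1 hp
      have hf : (n.factorial : ℂ) * ((a + b).choose a *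
          (i.descFactorial a * (i + 1).ascFactorial b) * (n - i + a).choose (a + b)) =
          n.choose i * i.choose a * (n - i).choose b * (n - i + a).factorial *
            (i + b).factorial := by
        exact_mod_cast factorial_mul_choose_mul_factorials hi a b
      have hq : (i.descFactorial a : ℂ) * (n.choose (a + b) *
          coord (2 * (a + b)) 0 (P (matUnit n (i - a) (i + b)))) =
          i.descFactorial a * ((n - i + a).choose (a + b) *
            coord (2 * (a + b)) 0 (P (matUnit n 0 (a + b)))) := by
        rcases lt_or_ge i a with ha | ha
        · simp [Nat.descFactorial_of_lt ha]
        rcases lt_or_ge n (i + b) with hb | hb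
        · rw [matUnit_of_lt_right hb, Nat.choose_eq_zero_of_lt (show n - i + a < a + b by omega)]
          simp
        have := choose_mul_coord_zero_apply_matUnit hPL (show i - a + (a + b) ≤ n by omega)
        rw [show i - a + (a + b) = i + b by omega, show n - (i - a) = n - i + a by omega] at this
        rw [this]
      have hs : (-1 : ℂ) ^ (a + b) * (-1) ^ a = (-1) ^ b := by
        rw [pow_add, mul_right_comm, ← mul_pow]; simp
      simp only
      linear_combination (n.factorial * (a + b).choose a * (-1) ^ b * (i + 1).ascFactorial b : ℂ) *
        hq + ((-1) ^ b * coord (2 * (a + b)) 0 (P (matUnit n 0 (a + b)))) * hf -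
        (coord (2 * (a + b)) 0 (P (matUnit n 0 (a + b))) * (n.choose i * i.choose a *
          (n - i).choose b * (n - i + a).factorial * (i + b).factorial)) * hs

end Equivariant

/-- If `P : End(Sym^n V) → Sym^{2k} V` is `sl(2)`-equivariant, then there is a constant `c`
such that for every upper triangular `T` with diagonal `(a_0, …, a_n)`, the components of
`P(T)` in the basis `(g_{2k,u})` vanish for `u > k`, and the `g_{2k,k}`-component equals
`c · Σ_i B_{n,k,i} a_i`. -/
theorem projection_of_upper_triangular (n k : ℕ) (hk : k ≤ n)
    (P : ((Fin (n + 1) → ℂ) →ₗ[ℂ] (Fin (n + 1) → ℂ)) →ₗ[ℂ] (Fin (2 * k + 1) → ℂ))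
    (hPL : ∀ T : (Fin (n + 1) → ℂ) →ₗ[ℂ] (Fin (n + 1) → ℂ),
      P ((Lop n).comp T - T.comp (Lop n)) = (Lop (2 * k)) (P T))
    (hPR : ∀ T : (Fin (n + 1) → ℂ) →ₗ[ℂ] (Fin (n + 1) → ℂ),
      P ((Rop n).comp T - T.comp (Rop n)) = (Rop (2 * k)) (P T)) :
    ∃ c : ℂ, ∀ (T : (Fin (n + 1) → ℂ) →ₗ[ℂ] (Fin (n + 1) → ℂ)) (a : Fin (n + 1) → ℂ),
      (∀ i j : Fin (n + 1), (j : ℕ) < (i : ℕ) → LinearMap.toMatrix' T i j = 0) →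
      (∀ i : Fin (n + 1), LinearMap.toMatrix' T i i = a i) →
      (∀ u : Fin (2 * k + 1), k < (u : ℕ) → P T u = 0) ∧
        P T ⟨k, by omega⟩ = c * ∑ i : Fin (n + 1), ((B n k (i : ℕ) : ℤ) : ℂ) * a i := by
  refine ⟨(-1) ^ k * coord (2 * k) 0 (P (matUnit n 0 k)) /
    (k.factorial * n.factorial * n.choose k), fun T a hT ha => ?_⟩
  have hPT (u : Fin (2 * k + 1)) : P T u = ∑ i : Fin (n + 1), ∑ j : Fin (n + 1),
      LinearMap.toMatrix' T i j * coord (2 * k) u (P (matUnit n i j)) := by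
    conv_lhs => rw [← coord_val (P T), eq_sum_matUnit T]
    simp only [map_sum, map_smul, smul_eq_mul]
  have hoff (u : Fin (2 * k + 1)) (hu : k ≤ u) (i j : Fin (n + 1)) (hij : k < u ∨ j ≠ i) :
      LinearMap.toMatrix' T i j * coord (2 * k) u (P (matUnit n i j)) = 0 := by
    rcases lt_or_ge (j : ℕ) i with h | h
    · rw [hT i j h, zero_mul]
    · have hne : k < u ∨ (j : ℕ) ≠ i := hij.imp_right fun h e => h (Fin.ext e)
      rw [coord_apply_matUnit_eq_zero hPL hPR (by omega) (by omega), mul_zero]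
  constructor
  · intro u hu
    rw [hPT]
    exact Finset.sum_eq_zero fun i _ => Finset.sum_eq_zero fun j _ => hoff u hu.le i j (.inl hu)
  · rw [hPT, Finset.mul_sum]
    refine Finset.sum_congr rfl fun i _ => ?_
    rw [Finset.sum_eq_single i (fun j _ h => hoff _ le_rfl i j (.inr h)) (by simp), ha,
      coord_apply_matUnit_diag hk hPL hPR (by omega)]
    ring
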